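/- arXiv:1911.05373 — 4 statements merged into one kernel-verified Lean document; each statement's English description precedes it below -/
import Mathlib

section
/- Let β > 0 and λ ∈ ℂ with λ ≠ 0. Suppose g : {−1,1} × [0,∞) → ℂ is differentiable in y, with g(σ,·) and y ↦ y·g(σ,y) integrable on [0,∞) for σ = ±1, and that g satisfies the eigen-system: (i) ∂g/∂y(σ,y) + y·g(σ,y) + λ·g(σ,y) = βσk·√(2/π)·y·e^{−y²/2} for all y ≥ 0 and σ ∈ {−1,1}, where k := 2∫₀^∞ g(1,y) dy; (ii) g(σ,0) = βσk·√(2/π) + ∫₀^∞ y·g(−σ,y) dy for σ ∈ {−1,1}; (iii) ∫₀^∞ (g(1,y) + g(−1,y)) dy = 0. If k ≠ 0 and g(1,0) ≠ 0, then H_{β,1}(λ) = 0, where H_{β,1}(λ) := H₁(λ)·(−4β − λ³·√(π/2)) + √(2π)·λ² − 4βλ + 2β·√(2π) and H₁(λ) := ∫₀^∞ e^{−y²/2} e^{−λy} dy. -/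
open MeasureTheory Set

/-- `H₁(λ) = ∫₀^∞ e^{-y²/2} e^{-λy} dy`. -/
noncomputable def H1 (l : ℂ) : ℂ :=
  ∫ y in Ioi (0:ℝ), Complex.exp (-(y:ℂ)^2 / 2) * Complex.exp (-(l * y))

/-- The `n`-th moment integrand of the Gaussian weight tilted by `e^{-my}`. -/
noncomputable def gaussMoment (m : ℂ) (n : ℕ) (y : ℝ) : ℂ :=
  (y:ℂ)^n * (Complex.exp (-(y:ℂ)^2 / 2) * Complex.exp (-(m * y)))

lemma continuous_gaussMoment (m : ℂ) (n : ℕ) : Continuous (gaussMoment m n) := by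
  unfold gaussMoment
  fun_prop

lemma norm_gaussMoment_le (m : ℂ) (n : ℕ) {y : ℝ} (hy : 0 ≤ y) :
    ‖gaussMoment m n y‖ ≤ n.factorial * Real.exp (-(1/2) * y^2 + (‖m‖ + 1) * y) := by
  have h1 : ‖Complex.exp (-(y:ℂ)^2 / 2)‖ = Real.exp (-(1/2) * y^2) := by
    rw [Complex.norm_exp]
    congr 1
    have : (-(y:ℂ)^2 / 2) = ((-(1/2) * y^2 : ℝ) : ℂ) := by push_cast; ring
    rw [this, Complex.ofReal_re]
  have h2 : ‖Complex.exp (-(m * y))‖ ≤ Real.exp (‖m‖ * y) := by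
    rw [Complex.norm_exp, Real.exp_le_exp]
    have := (Complex.abs_re_le_norm (-(m * y)))
    rw [norm_neg, norm_mul, Complex.norm_real, Real.norm_of_nonneg hy] at this
    exact (le_abs_self _).trans this
  have h3 : y^n ≤ n.factorial * Real.exp y := by
    have := Real.pow_div_factorial_le_exp y hy n
    rw [div_le_iff₀ (by positivity)] at this
    linarith
  unfold gaussMoment
  rw [norm_mul, norm_mul, norm_pow, Complex.norm_real, Real.norm_of_nonneg hy, h1]
  calc y^n * (Real.exp (-(1/2) * y^2) * ‖Complex.exp (-(m * y))‖)
      ≤ (n.factorial * Real.exp y) * (Real.exp (-(1/2) * y^2) * Real.exp (‖m‖ * y)) := by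
        gcongr
    _ = _ := by
        rw [mul_assoc, ← Real.exp_add, ← Real.exp_add]
        congr 2
        ring

lemma integrableOn_gaussMoment (m : ℂ) (n : ℕ) : IntegrableOn (gaussMoment m n) (Ioi 0) := by
  have hq := (integrable_cexp_quadratic (b := 1/2) (by norm_num) ((‖m‖ : ℂ) + 1) 0).norm
  refine Integrable.mono' ((hq.const_mul (n.factorial : ℝ)).integrableOn)
    (continuous_gaussMoment m n).aestronglyMeasurable ?_
  refine (ae_restrict_iff' measurableSet_Ioi).2 (.of_forall fun y hy => ?_)
  refine (norm_gaussMoment_le m n (le_of_lt hy)).trans (le_of_eq ?_)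
  rw [Complex.norm_exp]
  congr 2
  have : (-(1/2) * (y:ℂ)^2 + ((‖m‖ : ℂ) + 1) * y + 0)
      = ((-(1/2) * y^2 + (‖m‖ + 1) * y : ℝ) : ℂ) := by push_cast; ring
  rw [this, Complex.ofReal_re]

lemma tendsto_gaussMoment (m : ℂ) (n : ℕ) :
    Filter.Tendsto (gaussMoment m n) Filter.atTop (nhds 0) := by
  have hexp : Filter.Tendsto (fun y : ℝ => -(1/2) * y^2 + (‖m‖ + 1) * y)
      Filter.atTop Filter.atBot := by
    have h1 : Filter.Tendsto (fun y : ℝ => -(1/2) * y + (‖m‖ + 1)) Filter.atTop Filter.atBot :=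
      Filter.tendsto_atBot_add_const_right _ _
        (Filter.tendsto_id.const_mul_atTop_of_neg (by norm_num))
    exact (Filter.tendsto_id.atTop_mul_atBot₀ h1).congr fun y => by simp only [id]; ring
  refine squeeze_zero_norm' ((Filter.eventually_ge_atTop 0).mono fun y hy =>
    norm_gaussMoment_le m n hy) ?_
  simpa using (Real.tendsto_exp_atBot.comp hexp).const_mul (n.factorial : ℝ)

lemma hasDerivAt_gaussMoment (m : ℂ) (n : ℕ) (y : ℝ) :
    HasDerivAt (gaussMoment m n)
      (n * gaussMoment m (n - 1) y - m * gaussMoment m n y - gaussMoment m (n + 1) y) y := by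
  have hid : HasDerivAt (fun z : ℂ => z) 1 (y:ℂ) := hasDerivAt_id _
  have h1 := (((hid.pow 2).neg.div_const 2).cexp).mul ((hid.const_mul m).neg.cexp)
  have h2 := ((hid.pow n).mul h1).comp_ofReal
  refine h2.congr_deriv ?_
  simp only [gaussMoment, Pi.mul_apply, Pi.pow_apply, Pi.neg_apply]
  push_cast
  ring

lemma integral_gaussMoment_succ (m : ℂ) (n : ℕ) :
    ∫ y in Ioi (0:ℝ), gaussMoment m (n + 1) y
      = n * (∫ y in Ioi (0:ℝ), gaussMoment m (n - 1) y)
        - m * (∫ y in Ioi (0:ℝ), gaussMoment m n y) + 0 ^ n := by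
  have i0 := (integrableOn_gaussMoment m (n - 1)).const_mul (n : ℂ)
  have i1 := (integrableOn_gaussMoment m n).const_mul m
  have i2 := integrableOn_gaussMoment m (n + 1)
  have h := integral_Ioi_of_hasDerivAt_of_tendsto'
    (fun y _ => hasDerivAt_gaussMoment m n y) ((i0.sub i1).sub i2) (tendsto_gaussMoment m n)
  have e1 := integral_sub (i0.sub i1) i2
  have e2 := integral_sub i0 i1
  simp only [Pi.sub_apply, integral_const_mul] at e1 e2
  rw [e1, e2] at h
  have h0 : gaussMoment m n 0 = 0 ^ n := by simp [gaussMoment]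
  rw [h0] at h
  linear_combination -h

lemma integral_gaussMoment_zero_zero :
    ∫ y in Ioi (0:ℝ), gaussMoment 0 0 y = (Real.sqrt (Real.pi / 2) : ℂ) := by
  have h := integral_gaussian_Ioi (1/2)
  have h2 : Real.sqrt (Real.pi / (1/2)) / 2 = Real.sqrt (Real.pi / 2) := by
    rw [show Real.pi / (1/2) = 2^2 * (Real.pi / 2) by ring, Real.sqrt_mul (by norm_num),
      Real.sqrt_sq (by norm_num)]
    ring
  rw [← h2, ← h, ← integral_complex_ofReal]
  refine integral_congr_ae (.of_forall fun y => ?_)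
  simp only [gaussMoment]
  push_cast
  simp
  ring_nf

/-- Variation of constants for `u' + y u + l u = q y e^{-y²/2}` on `[0, ∞)`. -/
lemma eq_gaussMoment_of_ode {u u' : ℝ → ℂ} {l q : ℂ} (hl : l ≠ 0)
    (hu : ∀ y : ℝ, 0 ≤ y → HasDerivWithinAt u (u' y) (Ici 0) y)
    (hode : ∀ y : ℝ, 0 ≤ y →
      u' y + (y:ℂ) * u y + l * u y = q * (y:ℂ) * Complex.exp (-(y:ℂ)^2 / 2))
    {y : ℝ} (hy : 0 ≤ y) :
    u y = (u 0 + q / l^2) * gaussMoment l 0 y + q / l * gaussMoment 0 1 y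
      - q / l^2 * gaussMoment 0 0 y := by
  set E : ℝ → ℂ := fun x => Complex.exp ((x:ℂ)^2 / 2) * Complex.exp (l * x) with hE
  set P : ℝ → ℂ := fun x => q * Complex.exp (l * x) * ((x:ℂ) / l - 1 / l^2) with hP
  have hEd : ∀ x : ℝ, HasDerivAt E ((x + l) * E x) x := fun x => by
    have hid : HasDerivAt (fun z : ℂ => z) 1 (x:ℂ) := hasDerivAt_id _
    refine ((((hid.pow 2).div_const 2).cexp).mul ((hid.const_mul l).cexp)).comp_ofReal.congr_deriv
      ?_
    simp only [hE, Pi.pow_apply]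
    push_cast
    ring
  have hPd : ∀ x : ℝ, HasDerivAt P (q * x * Complex.exp (l * x)) x := fun x => by
    have hid : HasDerivAt (fun z : ℂ => z) 1 (x:ℂ) := hasDerivAt_id _
    refine ((((hid.const_mul l).cexp).const_mul q).mul
      ((hid.div_const l).sub_const (1 / l^2))).comp_ofReal.congr_deriv ?_
    field_simp
    ring
  have hmul : ∀ x : ℝ, E x * Complex.exp (-(x:ℂ)^2 / 2) = Complex.exp (l * x) := fun x => by
    simp only [hE]
    rw [← Complex.exp_add, ← Complex.exp_add]
    congr 1
    ring
  have hD : ∀ x : ℝ, 0 ≤ x → HasDerivWithinAt (fun x => E x * u x - P x) 0 (Ici 0) x :=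
    fun x hx => by
      refine (((hEd x).hasDerivWithinAt.mul (hu x hx)).sub
        (hPd x).hasDerivWithinAt).congr_deriv ?_
      linear_combination E x * hode x hx + q * x * hmul x
  have hconst := constant_of_has_deriv_right_zero (f := fun x => E x * u x - P x) (a := 0) (b := y)
    (fun x hx => ((hD x hx.1).continuousWithinAt).mono Icc_subset_Ici_self)
    (fun x hx => (hD x hx.1).mono (Ici_subset_Ici.2 hx.1)) y ⟨hy, le_rfl⟩
  have hE0 : E 0 = 1 := by simp [hE]
  have hP0 : P 0 = -q / l^2 := by simp [hP]; ring
  simp only [hE0, hP0] at hconst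
  have hinv : gaussMoment l 0 y * E y = 1 := by
    simp only [gaussMoment, hE, pow_zero, one_mul]
    rw [← Complex.exp_add, ← Complex.exp_add, ← Complex.exp_add]
    rw [Complex.exp_eq_one_iff]
    exact ⟨0, by push_cast; ring⟩
  have hGP : gaussMoment l 0 y * Complex.exp (l * y) = Complex.exp (-(y:ℂ)^2 / 2) := by
    simp only [gaussMoment, pow_zero, one_mul]
    rw [← Complex.exp_add, ← Complex.exp_add]
    congr 1
    ring
  have hm1 : gaussMoment 0 1 y = y * Complex.exp (-(y:ℂ)^2 / 2) := by simp [gaussMoment]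
  have hm0 : gaussMoment 0 0 y = Complex.exp (-(y:ℂ)^2 / 2) := by simp [gaussMoment]
  rw [hm1, hm0]
  simp only [hP] at hconst
  linear_combination gaussMoment l 0 y * hconst - u y * hinv + q * ((y:ℂ) / l - 1 / l^2) * hGP

lemma mul_gaussMoment (m : ℂ) (n : ℕ) (y : ℝ) :
    (y:ℂ) * gaussMoment m n y = gaussMoment m (n + 1) y := by
  unfold gaussMoment
  ring

lemma integral_gaussMoment_combination (l m a b c : ℂ) (i j n : ℕ) :
    ∫ y in Ioi (0:ℝ), (a * gaussMoment l i y + b * gaussMoment m j y - c * gaussMoment m n y)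
      = a * (∫ y in Ioi (0:ℝ), gaussMoment l i y) + b * (∫ y in Ioi (0:ℝ), gaussMoment m j y)
        - c * ∫ y in Ioi (0:ℝ), gaussMoment m n y := by
  have h1 := (integrableOn_gaussMoment l i).const_mul a
  have h2 := (integrableOn_gaussMoment m j).const_mul b
  have h3 := (integrableOn_gaussMoment m n).const_mul c
  have e1 := integral_sub (h1.add h2) h3
  have e2 := integral_add h1 h2
  simp only [Pi.add_apply, integral_const_mul] at e1 e2
  rw [e1, e2]

lemma integral_gaussMoment_zero_eq_H1 (l : ℂ) :
    ∫ y in Ioi (0:ℝ), gaussMoment l 0 y = H1 l := by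
  simp [gaussMoment, H1]

lemma integral_of_ode {u u' : ℝ → ℂ} {l q : ℂ} (hl : l ≠ 0)
    (hu : ∀ y : ℝ, 0 ≤ y → HasDerivWithinAt u (u' y) (Ici 0) y)
    (hode : ∀ y : ℝ, 0 ≤ y →
      u' y + (y:ℂ) * u y + l * u y = q * (y:ℂ) * Complex.exp (-(y:ℂ)^2 / 2)) :
    (∫ y in Ioi (0:ℝ), u y) = (u 0 + q / l^2) * H1 l + q / l
      - q / l^2 * (Real.sqrt (Real.pi / 2) : ℂ) ∧
    (∫ y in Ioi (0:ℝ), (y:ℂ) * u y) = (u 0 + q / l^2) * (1 - l * H1 l)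
      + q / l * (Real.sqrt (Real.pi / 2) : ℂ) - q / l^2 := by
  have h01 : ∫ y in Ioi (0:ℝ), gaussMoment 0 1 y = 1 := by
    simpa using integral_gaussMoment_succ 0 0
  have h02 : ∫ y in Ioi (0:ℝ), gaussMoment 0 2 y = (Real.sqrt (Real.pi / 2) : ℂ) := by
    simpa [integral_gaussMoment_zero_zero] using integral_gaussMoment_succ 0 1
  have hl1 : ∫ y in Ioi (0:ℝ), gaussMoment l 1 y = 1 - l * H1 l := by
    have := integral_gaussMoment_succ l 0
    rw [integral_gaussMoment_zero_eq_H1] at this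
    rw [this]
    simp
    ring
  constructor
  · rw [setIntegral_congr_fun measurableSet_Ioi
      (fun y hy => eq_gaussMoment_of_ode hl hu hode (le_of_lt hy)),
      integral_gaussMoment_combination, h01, integral_gaussMoment_zero_zero,
      integral_gaussMoment_zero_eq_H1, mul_one]
  · have hy : EqOn (fun y : ℝ => (y:ℂ) * u y) (fun y => (u 0 + q / l^2) * gaussMoment l 1 y
        + q / l * gaussMoment 0 2 y - q / l^2 * gaussMoment 0 1 y) (Ioi 0) := fun y hy => by
      simp only [eq_gaussMoment_of_ode hl hu hode (le_of_lt hy), ← mul_gaussMoment _ 1 y,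
        ← mul_gaussMoment _ 0 y]
      ring
    rw [setIntegral_congr_fun measurableSet_Ioi hy,
      integral_gaussMoment_combination, h01, h02, hl1, mul_one]

/-- any nontrivial solution of the linearized eigen-system for γ = 1
forces `H_{β,1}(λ) = 0`. -/
theorem stmt_1 (β : ℝ) (hβ : 0 < β) (l : ℂ) (hl : l ≠ 0)
    (g : ℝ → ℝ → ℂ) (g' : ℝ → ℝ → ℂ) (k : ℂ)
    (hk : k = 2 * ∫ y in Ioi (0:ℝ), g 1 y)
    (hderiv : ∀ σ ∈ ({-1, 1} : Set ℝ), ∀ y : ℝ, 0 ≤ y →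
      HasDerivWithinAt (g σ) (g' σ y) (Ici 0) y)
    (hint₁ : ∀ σ ∈ ({-1, 1} : Set ℝ), IntegrableOn (g σ) (Ioi 0))
    (hint₂ : ∀ σ ∈ ({-1, 1} : Set ℝ), IntegrableOn (fun y : ℝ => (y:ℂ) * g σ y) (Ioi 0))
    (heq : ∀ σ ∈ ({-1, 1} : Set ℝ), ∀ y : ℝ, 0 ≤ y →
      g' σ y + (y:ℂ) * g σ y + l * g σ y
        = (β:ℂ) * (σ:ℂ) * k * (Real.sqrt (2 / Real.pi) : ℂ) * (y:ℂ)
            * Complex.exp (-(y:ℂ)^2 / 2))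
    (hbdry : ∀ σ ∈ ({-1, 1} : Set ℝ),
      g σ 0 = (β:ℂ) * (σ:ℂ) * k * (Real.sqrt (2 / Real.pi) : ℂ)
        + ∫ y in Ioi (0:ℝ), (y:ℂ) * g (-σ) y)
    (hzero : (∫ y in Ioi (0:ℝ), (g 1 y + g (-1) y)) = 0)
    (hk0 : k ≠ 0) (hg10 : g 1 0 ≠ 0) :
    H1 l * (-4 * (β:ℂ) - l^3 * (Real.sqrt (Real.pi / 2) : ℂ))
      + (Real.sqrt (2 * Real.pi) : ℂ) * l^2 - 4 * (β:ℂ) * l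
      + 2 * (β:ℂ) * (Real.sqrt (2 * Real.pi) : ℂ) = 0 := by
  have hp : (1:ℝ) ∈ ({-1, 1} : Set ℝ) := by simp
  have hm : (-1:ℝ) ∈ ({-1, 1} : Set ℝ) := by simp
  set s : ℂ := (Real.sqrt (Real.pi / 2) : ℂ) with hs
  set c : ℂ := (Real.sqrt (2 / Real.pi) : ℂ) with hc
  have hsc : c * s = 1 := by
    rw [hs, hc, ← Complex.ofReal_mul, ← Real.sqrt_mul (by positivity)]
    have : 2 / Real.pi * (Real.pi / 2) = 1 := by field_simp
    rw [this]
    simp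
  have h2s : (Real.sqrt (2 * Real.pi) : ℂ) = 2 * s := by
    rw [hs, show 2 * Real.pi = 2^2 * (Real.pi / 2) by ring, Real.sqrt_mul (by norm_num),
      Real.sqrt_sq (by norm_num)]
    push_cast
    ring
  obtain ⟨p0, -⟩ := integral_of_ode hl (hderiv 1 hp) (heq 1 hp)
  obtain ⟨m0, m1⟩ := integral_of_ode hl (hderiv (-1) hm) (heq (-1) hm)
  have bp := hbdry 1 hp
  rw [m1] at bp
  rw [integral_add (hint₁ 1 hp) (hint₁ (-1) hm)] at hzero
  rw [p0, m0] at hzero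
  rw [p0] at hk
  rw [h2s]
  simp only [← hs, Complex.ofReal_one, Complex.ofReal_neg] at bp hk hzero
  generalize H1 l = H at *
  generalize g 1 0 = a at *
  generalize g (-1) 0 = b at *
  obtain ⟨q, hq⟩ : ∃ q : ℂ, q = (β:ℂ) * k * c := ⟨_, rfl⟩
  have hqs : q * s = β * k := by linear_combination s * hq + β * k * hsc
  have hk' : k * l^2 = 2 * ((a * l^2 + q) * H + q * l - q * s) := by
    rw [hq]
    field_simp at hk
    linear_combination hk
  have hzero' : (a + b) * H = 0 := by linear_combination hzero
  have bp' : a * l^2 = q * l^2 + (b * l^2 - q) * (1 - l * H) - q * s * l + q := by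
    rw [hq]
    field_simp at bp
    linear_combination bp
  refine (mul_eq_zero.1 (?_ : k * _ = 0)).resolve_left hk0
  rcases mul_eq_zero.1 hzero' with hab | hH
  · obtain rfl : b = -a := by linear_combination hab
    linear_combination s * (2 - l * H) * hk' + 2 * s * H * bp' + 4 * (l + H - s) * hqs
  · subst hH
    linear_combination 2 * s * hk' + 4 * (l - s) * hqs
end

section
/- The function H₁(λ) := ∫₀^∞ e^{−y²/2} e^{−λy} dy is an entire (everywhere holomorphic) function of λ ∈ ℂ, and for every λ ∈ ℂ it admits the series representation H₁(λ) = √(π/2) · Σ_{m=0}^∞ λ^{2m}/(2m)!! − λ · Σ_{m=0}^∞ (2λ)^{2m} · m! / ((2m+1)! · 2^m), both series converging absolutely. -/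
open MeasureTheory Set

/-- The `n`-th absolute moment of the unnormalised Gaussian weight on the half line. -/
noncomputable def halfGaussianMoment (n : ℕ) : ℝ :=
  ∫ y in Ioi (0:ℝ), y ^ n * Real.exp (-y ^ 2 / 2)

theorem halfGaussianMoment_eq_Gamma (n : ℕ) :
    halfGaussianMoment n =
      (1 / 2 : ℝ) ^ (-((n : ℝ) + 1) / 2) * (1 / 2) * Real.Gamma (((n : ℝ) + 1) / 2) := by
  rw [← integral_rpow_mul_exp_neg_mul_rpow (by norm_num)
    (by linarith [(Nat.cast_nonneg n : (0:ℝ) ≤ n)]) (by norm_num), halfGaussianMoment]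
  congr 1 with y
  rw [Real.rpow_natCast, Real.rpow_two]
  ring_nf

theorem halfGaussianMoment_zero : halfGaussianMoment 0 = √(Real.pi / 2) := by
  have h := integral_gaussian_Ioi (1 / 2)
  have h2 : √(Real.pi / (1 / 2)) / 2 = √(Real.pi / 2) := by
    rw [show Real.pi / (1 / 2) = 2 ^ 2 * (Real.pi / 2) by ring,
      Real.sqrt_mul (by norm_num), Real.sqrt_sq (by norm_num)]
    ring
  rw [← h2, ← h, halfGaussianMoment]
  congr 1 with y
  ring_nf

theorem halfGaussianMoment_one : halfGaussianMoment 1 = 1 := by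
  rw [halfGaussianMoment_eq_Gamma]
  norm_num [Real.rpow_neg_one]

theorem halfGaussianMoment_add_two (n : ℕ) :
    halfGaussianMoment (n + 2) = (n + 1) * halfGaussianMoment n := by
  have h0 : (0:ℝ) < ((n : ℝ) + 1) / 2 := by positivity
  have hexp : -(((n + 2 : ℕ) : ℝ) + 1) / 2 = -((n : ℝ) + 1) / 2 + (-1) := by push_cast; ring
  have harg : (((n + 2 : ℕ) : ℝ) + 1) / 2 = ((n : ℝ) + 1) / 2 + 1 := by push_cast; ring
  rw [halfGaussianMoment_eq_Gamma, halfGaussianMoment_eq_Gamma, hexp, harg,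
    Real.Gamma_add_one h0.ne', Real.rpow_add (by norm_num), Real.rpow_neg_one]
  ring

theorem halfGaussianMoment_even_div_factorial (m : ℕ) :
    halfGaussianMoment (2 * m) / (2 * m).factorial =
      √(Real.pi / 2) / (2 * m).doubleFactorial := by
  induction m with
  | zero => simp [halfGaussianMoment_zero]
  | succ m ih =>
    rw [Nat.mul_succ, halfGaussianMoment_add_two, Nat.doubleFactorial_add_two,
      Nat.factorial_succ, Nat.factorial_succ]
    push_cast
    rw [show (2 * (m : ℝ) + 1) * halfGaussianMoment (2 * m) /
        ((2 * m + 1 + 1) * ((2 * m + 1) * (2 * m).factorial)) =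
        halfGaussianMoment (2 * m) / (2 * m).factorial / (2 * m + 2) by field_simp; ring, ih]
    field_simp

theorem halfGaussianMoment_odd (m : ℕ) :
    halfGaussianMoment (2 * m + 1) = 2 ^ m * m.factorial := by
  induction m with
  | zero => simp [halfGaussianMoment_one]
  | succ m ih =>
    rw [show 2 * (m + 1) + 1 = 2 * m + 1 + 2 by ring, halfGaussianMoment_add_two, ih,
      Nat.factorial_succ]
    push_cast
    ring

theorem integrable_exp_mul_exp_neg_sq_div_two (r : ℝ) :
    Integrable fun y : ℝ => Real.exp (r * y) * Real.exp (-y ^ 2 / 2) := by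
  have h := ((integrable_exp_neg_mul_sq (b := 1 / 2) (by norm_num)).comp_sub_right r).const_mul
    (Real.exp (r ^ 2 / 2))
  refine h.congr (.of_forall fun y => ?_)
  simp only [← Real.exp_add]
  ring_nf

theorem hasSum_mul_pow_div_factorial_mul {𝕂 : Type*} [RCLike 𝕂] (x w : 𝕂) :
    HasSum (fun n : ℕ => x ^ n / n.factorial * w) (NormedSpace.exp x * w) :=
  (NormedSpace.expSeries_div_hasSum_exp x).mul_right w

theorem integral_pow_div_factorial_mul_cexp_neg_sq (l : ℂ) (n : ℕ) :
    ∫ y in Ioi (0:ℝ), (-(l * (y:ℂ))) ^ n / n.factorial * Complex.exp (-(y:ℂ) ^ 2 / 2) =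
      ((-1) ^ n * (halfGaussianMoment n : ℂ) / n.factorial) * l ^ n := by
  have h (y : ℝ) : (-(l * (y:ℂ))) ^ n / n.factorial * Complex.exp (-(y:ℂ) ^ 2 / 2) =
      ((-1) ^ n / n.factorial * l ^ n) * ((y ^ n * Real.exp (-y ^ 2 / 2) : ℝ) : ℂ) := by
    rw [neg_pow, mul_pow]
    push_cast
    ring
  simp_rw [h]
  rw [integral_const_mul, integral_complex_ofReal, ← halfGaussianMoment]
  ring

theorem hasSum_H1 (l : ℂ) :
    HasSum (fun n : ℕ => ((-1) ^ n * (halfGaussianMoment n : ℂ) / n.factorial) * l ^ n)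
      (H1 l) := by
  have hsum (y : ℝ) : HasSum
      (fun n : ℕ => (‖l‖ * y) ^ n / n.factorial * Real.exp (-y ^ 2 / 2))
      (Real.exp (‖l‖ * y) * Real.exp (-y ^ 2 / 2)) := by
    simpa only [← Real.exp_eq_exp_ℝ] using
      hasSum_mul_pow_div_factorial_mul (‖l‖ * y) (Real.exp (-y ^ 2 / 2))
  have hlim (y : ℝ) : HasSum
      (fun n : ℕ => (-(l * (y:ℂ))) ^ n / n.factorial * Complex.exp (-(y:ℂ) ^ 2 / 2))
      (Complex.exp (-(y:ℂ) ^ 2 / 2) * Complex.exp (-(l * y))) := by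
    rw [mul_comm (Complex.exp _)]
    simpa only [← Complex.exp_eq_exp_ℂ] using
      hasSum_mul_pow_div_factorial_mul (-(l * (y:ℂ))) (Complex.exp (-(y:ℂ) ^ 2 / 2))
  have hbound (n : ℕ) (y : ℝ) (hy : y ∈ Ioi (0:ℝ)) :
      ‖(-(l * (y:ℂ))) ^ n / n.factorial * Complex.exp (-(y:ℂ) ^ 2 / 2)‖ ≤
        (‖l‖ * y) ^ n / n.factorial * Real.exp (-y ^ 2 / 2) := by
    have hre : -(y:ℂ) ^ 2 / 2 = ((-y ^ 2 / 2 : ℝ) : ℂ) := by push_cast; rfl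
    rw [norm_mul, norm_div, norm_pow, norm_neg, norm_mul, hre, Complex.norm_exp_ofReal,
      Complex.norm_real, Real.norm_of_nonneg (le_of_lt hy), Complex.norm_natCast]
  have hint : Integrable
      (fun y : ℝ => ∑' n : ℕ, (‖l‖ * y) ^ n / n.factorial * Real.exp (-y ^ 2 / 2))
      (volume.restrict (Ioi 0)) := by
    simp_rw [fun y => (hsum y).tsum_eq]
    exact (integrable_exp_mul_exp_neg_sq_div_two ‖l‖).integrableOn
  simp_rw [← integral_pow_div_factorial_mul_cexp_neg_sq]
  exact hasSum_integral_of_dominated_convergence _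
    (fun n => Continuous.aestronglyMeasurable (by fun_prop))
    (fun n => (ae_restrict_mem measurableSet_Ioi).mono (hbound n))
    (.of_forall fun y => (hsum y).summable) hint (.of_forall hlim)

/-- A power series that converges everywhere has an entire sum. -/
theorem differentiable_of_hasSum_mul_pow {c : ℕ → ℂ} {f : ℂ → ℂ}
    (h : ∀ z, HasSum (fun n => c n * z ^ n) (f z)) : Differentiable ℂ f := by
  intro z
  obtain rfl : f = fun z => ∑' n, c n * z ^ n := funext fun z => (h z).tsum_eq.symm
  set r : ℝ := ‖z‖ + 1 with hr
  have hr0 : 0 ≤ r := by positivity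
  have hd : DifferentiableOn ℂ (fun z => ∑' n, c n * z ^ n) (Metric.ball 0 r) := by
    refine Complex.differentiableOn_tsum_of_summable_norm (u := fun n => ‖c n * (r : ℂ) ^ n‖)
      (h r).summable.norm (fun n => by fun_prop) Metric.isOpen_ball fun n w hw => ?_
    rw [norm_mul, norm_mul, norm_pow, norm_pow, Complex.norm_real, Real.norm_of_nonneg hr0]
    have : ‖w‖ ≤ r := (mem_ball_zero_iff.mp hw).le
    gcongr
  exact hd.differentiableAt (Metric.isOpen_ball.mem_nhds (by simp [hr]))

/-- `H₁` is entire and admits the stated absolutely convergent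
series representation. -/
theorem stmt_3 :
    Differentiable ℂ H1 ∧
    ∀ l : ℂ,
      (Summable fun m : ℕ => ‖l ^ (2*m) / ((2*m).doubleFactorial : ℂ)‖) ∧
      (Summable fun m : ℕ =>
        ‖(2*l) ^ (2*m) * (m.factorial : ℂ) / (((2*m+1).factorial : ℂ) * 2 ^ m)‖) ∧
      H1 l = (Real.sqrt (Real.pi / 2) : ℂ)
            * ∑' m : ℕ, l ^ (2*m) / ((2*m).doubleFactorial : ℂ)
          - l * ∑' m : ℕ,
              (2*l) ^ (2*m) * (m.factorial : ℂ) / (((2*m+1).factorial : ℂ) * 2 ^ m) := by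
  refine ⟨differentiable_of_hasSum_mul_pow hasSum_H1, fun l => ?_⟩
  set a : ℕ → ℂ := fun n => ((-1) ^ n * (halfGaussianMoment n : ℂ) / n.factorial) * l ^ n with ha
  set E : ℕ → ℂ := fun m => l ^ (2*m) / ((2*m).doubleFactorial : ℂ)
  set O : ℕ → ℂ := fun m =>
    (2*l) ^ (2*m) * (m.factorial : ℂ) / (((2*m+1).factorial : ℂ) * 2 ^ m) with hO
  have heven (m : ℕ) : a (2 * m) = (√(Real.pi / 2) : ℂ) * E m := by
    have h : (halfGaussianMoment (2 * m) : ℂ) / (2 * m).factorial =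
        (√(Real.pi / 2) : ℂ) / (2 * m).doubleFactorial := by
      exact_mod_cast congrArg Complex.ofReal (halfGaussianMoment_even_div_factorial m)
    simp only [ha, E, pow_mul (-1 : ℂ), neg_one_sq, one_pow, one_mul, h]
    ring
  have hodd (m : ℕ) : a (2 * m + 1) = -l * O m := by
    have h4 : (2:ℂ) ^ (2 * m) = 2 ^ m * 2 ^ m := by rw [two_mul, pow_add]
    have h1 : (-1:ℂ) ^ (2 * m + 1) = -1 := Odd.neg_one_pow ⟨m, rfl⟩
    simp only [ha, hO, halfGaussianMoment_odd, h1, mul_pow, h4]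
    push_cast
    field_simp
    ring
  have hsum : HasSum a (H1 l) := hasSum_H1 l
  have hs : (√(Real.pi / 2) : ℂ) ≠ 0 := by
    exact_mod_cast (Real.sqrt_pos.mpr (by positivity)).ne'
  have hE : Summable E := by
    have := hsum.summable.comp_injective (i := fun m : ℕ => 2 * m) fun _ _ h => by simpa using h
    simpa only [Function.comp_def, heven, summable_mul_left_iff hs] using this
  have hOs : Summable O := by
    rcases eq_or_ne l 0 with rfl | hl
    · refine summable_of_ne_finset_zero (s := {0}) fun m hm => ?_
      simp_all
    · have := hsum.summable.comp_injective (i := fun m : ℕ => 2 * m + 1)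
        fun _ _ h => by simpa using h
      simpa only [Function.comp_def, hodd, summable_mul_left_iff (neg_ne_zero.mpr hl)] using this
  refine ⟨hE.norm, hOs.norm, hsum.unique ?_⟩
  rw [sub_eq_add_neg, ← neg_mul]
  refine HasSum.even_add_odd ?_ ?_
  · simpa only [heven] using hE.hasSum.mul_left _
  · simpa only [hodd] using hOs.hasSum.mul_left _
end

section
/- For every λ ∈ ℂ, ∫₀^∞ y² · e^{−y³/3} e^{−λy} · ( −2 + 2e^{λy} − 2λy·e^{λy} + λ²y²·e^{λy} ) dy = 2λ·H₂(λ) − 2λ·3^{1/3}·Γ(4/3) + λ²·3^{2/3}·Γ(5/3), where H₂(λ) := ∫₀^∞ e^{−y³/3} e^{−λy} dy. -/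
open MeasureTheory Set

/-- `H₂(λ) = ∫₀^∞ e^{-y³/3} e^{-λy} dy`. -/
noncomputable def H2 (l : ℂ) : ℂ :=
  ∫ y in Ioi (0:ℝ), Complex.exp (-(y:ℂ)^3 / 3) * Complex.exp (-(l * y))

open Filter Topology Asymptotics in
/-- The weight `e^{-y³/3} e^{-cy}` times any power of `y` decays at least like `e^{-y}`. -/
theorem pow_mul_exp_neg_cube_isBigO (n : ℕ) (c : ℂ) :
    (fun y : ℝ => (y:ℂ)^n * (Complex.exp (-(y:ℂ)^3 / 3) * Complex.exp (-(c * y))))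
      =O[atTop] fun y : ℝ => Real.exp (-1 * y) := by
  refine IsBigO.of_bound (n.factorial : ℝ) ?_
  filter_upwards [eventually_ge_atTop (3 * (|c.re| + 2) + 1)] with y hy
  have hc := abs_nonneg c.re
  have hy0 : 0 ≤ y := by linarith
  have hnorm : ‖(y:ℂ)^n * (Complex.exp (-(y:ℂ)^3 / 3) * Complex.exp (-(c * y)))‖
      = y^n * Real.exp (-y^3 / 3 - c.re * y) := by
    rw [norm_mul, ← Complex.exp_add, Complex.norm_exp, norm_pow, Complex.norm_real,
      Real.norm_of_nonneg hy0]
    have h3 : -(y:ℂ)^3 / 3 = ((-y^3 / 3 : ℝ) : ℂ) := by push_cast; ring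
    rw [h3, Complex.add_re, Complex.ofReal_re, Complex.neg_re, Complex.re_mul_ofReal,
      ← sub_eq_add_neg]
  rw [hnorm, Real.norm_of_nonneg (Real.exp_pos _).le]
  have hpow : y^n ≤ n.factorial * Real.exp y := by
    have := Real.pow_div_factorial_le_exp y hy0 n
    rwa [div_le_iff₀ (by positivity), mul_comm] at this
  have hsq : 3 * (|c.re| + 2) ≤ y^2 := by nlinarith
  have hcube : y + (-y^3 / 3 - c.re * y) ≤ -1 * y := by
    have h1 := mul_le_mul_of_nonneg_right hsq hy0
    have h2 := mul_le_mul_of_nonneg_right (neg_abs_le c.re) hy0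
    nlinarith
  calc y^n * Real.exp (-y^3 / 3 - c.re * y)
      ≤ n.factorial * Real.exp y * Real.exp (-y^3 / 3 - c.re * y) := by gcongr
    _ = n.factorial * Real.exp (y + (-y^3 / 3 - c.re * y)) := by rw [Real.exp_add]; ring
    _ ≤ n.factorial * Real.exp (-1 * y) := by gcongr

theorem integrableOn_pow_mul_exp_neg_cube (n : ℕ) (c : ℂ) :
    IntegrableOn (fun y : ℝ => (y:ℂ)^n * (Complex.exp (-(y:ℂ)^3 / 3) * Complex.exp (-(c * y))))
      (Ioi 0) := by
  have hcont : Continuous fun y : ℝ =>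
      (y:ℂ)^n * (Complex.exp (-(y:ℂ)^3 / 3) * Complex.exp (-(c * y))) := by fun_prop
  exact (integrable_norm_iff hcont.aestronglyMeasurable).mp
    (integrable_of_isBigO_exp_neg one_pos hcont.norm.continuousOn
      (pow_mul_exp_neg_cube_isBigO n c).norm_left)

open Filter Topology in
/-- Integration of the derivative of `-e^{-y³/3} e^{-cy}`. -/
theorem integral_sq_mul_exp_neg_cube (c : ℂ) :
    ∫ y in Ioi (0:ℝ), (y:ℂ)^2 * (Complex.exp (-(y:ℂ)^3 / 3) * Complex.exp (-(c * y)))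
      = 1 - c * H2 c := by
  have h2 := integrableOn_pow_mul_exp_neg_cube 2 c
  have h0 : IntegrableOn (fun y : ℝ => Complex.exp (-(y:ℂ)^3 / 3) * Complex.exp (-(c * y)))
      (Ioi 0) := by
    simpa only [pow_zero, one_mul] using integrableOn_pow_mul_exp_neg_cube 0 c
  have hderiv : ∀ y ∈ Ici (0:ℝ), HasDerivAt
      (fun y : ℝ => -(Complex.exp (-(y:ℂ)^3 / 3) * Complex.exp (-(c * y))))
      ((y:ℂ)^2 * (Complex.exp (-(y:ℂ)^3 / 3) * Complex.exp (-(c * y)))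
        + c * (Complex.exp (-(y:ℂ)^3 / 3) * Complex.exp (-(c * y)))) y := by
    intro y _
    have hy : HasDerivAt (fun y : ℝ => (y:ℂ)) 1 y := Complex.ofRealCLM.hasDerivAt
    refine ((((hy.fun_pow 3).fun_neg.div_const 3).cexp.fun_mul
      (hy.const_mul c).fun_neg.cexp).fun_neg).congr_deriv ?_
    push_cast
    ring
  have hlim : Tendsto (fun y : ℝ => -(Complex.exp (-(y:ℂ)^3 / 3) * Complex.exp (-(c * y))))
      atTop (𝓝 0) := by
    have hexp : Tendsto (fun y : ℝ => Real.exp (-1 * y)) atTop (𝓝 0) := by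
      simpa only [neg_one_mul] using Real.tendsto_exp_neg_atTop_nhds_zero
    simpa using ((pow_mul_exp_neg_cube_isBigO 0 c).trans_tendsto hexp).neg
  have key := integral_Ioi_of_hasDerivAt_of_tendsto' hderiv (h2.add (h0.const_mul c)) hlim
  rw [integral_add h2 (h0.const_mul c), integral_const_mul] at key
  rw [H2, eq_sub_iff_add_eq, key]
  simp

/-- The moments of `e^{-y³/3}` on the half-line. -/
theorem integral_pow_mul_exp_neg_cube (n : ℕ) :
    ∫ y in Ioi (0:ℝ), (y:ℂ)^n * (Complex.exp (-(y:ℂ)^3 / 3) * Complex.exp (-(0 * y)))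
      = (((3:ℝ) ^ (((n:ℝ) - 2) / 3) * Real.Gamma (((n:ℝ) + 1) / 3) : ℝ) : ℂ) := by
  have hmoment := integral_rpow_mul_exp_neg_mul_rpow (p := 3) (q := n) (b := 1/3)
    (by norm_num) (by linarith [n.cast_nonneg (α := ℝ)]) (by norm_num)
  have hconst : ((1:ℝ)/3) ^ (-((n:ℝ) + 1) / 3) * (1 / 3) = (3:ℝ) ^ (((n:ℝ) - 2) / 3) := by
    rw [one_div, Real.inv_rpow (by norm_num), ← Real.rpow_neg (by norm_num),
      ← Real.rpow_neg_one, ← Real.rpow_add (by norm_num)]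
    ring_nf
  rw [← hconst, ← hmoment, ← integral_complex_ofReal]
  refine setIntegral_congr_fun measurableSet_Ioi fun y _ => ?_
  have h3 : y ^ (3:ℝ) = y ^ 3 := by exact_mod_cast Real.rpow_natCast y 3
  simp only [Real.rpow_natCast, h3]
  push_cast
  rw [zero_mul, neg_zero, Complex.exp_zero, mul_one]
  ring_nf

/-- `∫₀^∞ y² e^{-y³/3} e^{-λy} (-2 + 2e^{λy} - 2λy e^{λy} + λ²y² e^{λy}) dy
  = 2λ H₂(λ) - 2λ 3^{1/3} Γ(4/3) + λ² 3^{2/3} Γ(5/3)`. -/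
theorem stmt_14 (l : ℂ) :
    (∫ y in Ioi (0:ℝ), (y:ℂ)^2 * Complex.exp (-(y:ℂ)^3 / 3) * Complex.exp (-(l * y))
        * (-2 + 2 * Complex.exp (l * y) - 2 * l * (y:ℂ) * Complex.exp (l * y)
            + l^2 * (y:ℂ)^2 * Complex.exp (l * y)))
      = 2 * l * H2 l - 2 * l * ((3:ℝ) ^ ((1:ℝ)/3) : ℝ) * (Real.Gamma (4/3) : ℂ)
        + l^2 * ((3:ℝ) ^ ((2:ℝ)/3) : ℝ) * (Real.Gamma (5/3) : ℂ) := by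
  have hint := integrableOn_pow_mul_exp_neg_cube
  have hsplit : ∀ y : ℝ, (y:ℂ)^2 * Complex.exp (-(y:ℂ)^3 / 3) * Complex.exp (-(l * y))
        * (-2 + 2 * Complex.exp (l * y) - 2 * l * (y:ℂ) * Complex.exp (l * y)
            + l^2 * (y:ℂ)^2 * Complex.exp (l * y))
      = -2 * ((y:ℂ)^2 * (Complex.exp (-(y:ℂ)^3 / 3) * Complex.exp (-(l * y))))
        + 2 * ((y:ℂ)^2 * (Complex.exp (-(y:ℂ)^3 / 3) * Complex.exp (-(0 * y))))
        + -2 * l * ((y:ℂ)^3 * (Complex.exp (-(y:ℂ)^3 / 3) * Complex.exp (-(0 * y))))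
        + l^2 * ((y:ℂ)^4 * (Complex.exp (-(y:ℂ)^3 / 3) * Complex.exp (-(0 * y)))) := by
    intro y
    have hinv : Complex.exp (-(l * y)) * Complex.exp (l * y) = 1 := by
      rw [← Complex.exp_add, neg_add_cancel, Complex.exp_zero]
    rw [zero_mul, neg_zero, Complex.exp_zero]
    linear_combination ((y:ℂ)^2 * Complex.exp (-(y:ℂ)^3 / 3)
      * (2 - 2 * l * y + l^2 * (y:ℂ)^2)) * hinv
  simp_rw [hsplit]
  have i1 := (hint 2 l).const_mul (-2)
  have i2 := (hint 2 0).const_mul 2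
  have i3 := (hint 3 0).const_mul (-2 * l)
  have i4 := (hint 4 0).const_mul (l^2)
  rw [integral_add ((i1.fun_add i2).fun_add i3) i4, integral_add (i1.fun_add i2) i3, integral_add i1 i2]
  simp only [integral_const_mul]
  rw [integral_sq_mul_exp_neg_cube, integral_sq_mul_exp_neg_cube,
    integral_pow_mul_exp_neg_cube, integral_pow_mul_exp_neg_cube]
  norm_num
  ring
end

section
/- Fix β > 0 and T > 0. Then there exists a constant C > 0 (depending only on β and T) such that for all y, ỹ ∈ [0,T], all m, m̃ ∈ [−1,1], and all σ, σ̃ ∈ {−1,1}, setting λ(σ,m,y) := y·e^{−2βσm} and f₂(σ,ξ,m,y) := −y·𝟙_{(0,λ(σ,m,y))}(ξ), one has ∫₀^∞ | f₂(σ,ξ,m,y) − f₂(σ̃,ξ,m̃,ỹ) | dξ ≤ C·( |m − m̃| + |y − ỹ| + |σ − σ̃| ). -/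
open MeasureTheory Set

lemma setIntegral_Ioi_indicator_Ioo {a : ℝ} (ha : 0 ≤ a) :
    ∫ ξ in Ioi (0:ℝ), (Ioo (0:ℝ) a).indicator (fun _ => (1:ℝ)) ξ = a := by
  rw [setIntegral_indicator measurableSet_Ioo, inter_eq_right.2 Ioo_subset_Ioi_self]
  simp [ha]

lemma integrableOn_Ioi_indicator_Ioo (a : ℝ) :
    IntegrableOn ((Ioo (0:ℝ) a).indicator (fun _ => (1:ℝ))) (Ioi 0) := by
  refine Integrable.integrableOn ?_
  rw [integrable_indicator_iff measurableSet_Ioo]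
  exact integrableOn_const (by simp)

/-- The `L¹` distance of two multiples of indicators of intervals starting at `0`. -/
lemma integral_abs_sub_indicator_Ioo_le {a b : ℝ} (ha : 0 ≤ a) (hb : 0 ≤ b) (y y' : ℝ) :
    (∫ ξ in Ioi (0:ℝ), |(-y * (Ioo (0:ℝ) a).indicator (fun _ => (1:ℝ)) ξ)
        - (-y' * (Ioo (0:ℝ) b).indicator (fun _ => (1:ℝ)) ξ)|)
      ≤ |y - y'| * a + |y'| * |a - b| := by
  have hi := integrableOn_Ioi_indicator_Ioo
  have hd : IntegrableOn (fun ξ => |y'| * ((Ioo (0:ℝ) (max a b)).indicator (fun _ => (1:ℝ)) ξ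
      - (Ioo (0:ℝ) (min a b)).indicator (fun _ => (1:ℝ)) ξ)) (Ioi 0) :=
    ((hi _).sub (hi _)).const_mul _
  have hc : IntegrableOn (fun ξ => |y - y'| * (Ioo (0:ℝ) a).indicator (fun _ => (1:ℝ)) ξ)
      (Ioi 0) := (hi a).const_mul _
  calc _ ≤ ∫ ξ in Ioi (0:ℝ), (|y - y'| * (Ioo (0:ℝ) a).indicator (fun _ => (1:ℝ)) ξ
          + |y'| * ((Ioo (0:ℝ) (max a b)).indicator (fun _ => (1:ℝ)) ξ
            - (Ioo (0:ℝ) (min a b)).indicator (fun _ => (1:ℝ)) ξ)) := by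
        refine setIntegral_mono_on (((hi a).const_mul _).sub ((hi b).const_mul _)).abs
          (hc.add hd) measurableSet_Ioi fun ξ hξ => ?_
        have h0 : 0 < ξ := hξ
        by_cases h1 : ξ < a <;> by_cases h2 : ξ < b <;>
          simp [h0, h1, h2, abs_sub_comm, neg_add_eq_sub]
        linarith [abs_sub_abs_le_abs_sub y y', abs_sub_comm y y']
    _ = |y - y'| * a + |y'| * |a - b| := by
        rw [integral_add hc hd, integral_const_mul, integral_const_mul,
          integral_sub (hi _) (hi _), setIntegral_Ioi_indicator_Ioo ha,
          setIntegral_Ioi_indicator_Ioo (ha.trans (le_max_left a b)),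
          setIntegral_Ioi_indicator_Ioo (le_min ha hb), max_sub_min_eq_abs, abs_sub_comm b a]

lemma abs_exp_sub_exp_le {u v M : ℝ} (hu : u ≤ M) (hv : v ≤ M) :
    |Real.exp u - Real.exp v| ≤ Real.exp M * |u - v| := by
  wlog h : v ≤ u generalizing u v
  · rw [abs_sub_comm, abs_sub_comm u]
    exact this hv hu (le_of_not_ge h)
  rw [abs_of_nonneg (sub_nonneg.2 (Real.exp_le_exp.2 h)), abs_of_nonneg (sub_nonneg.2 h)]
  have h1 : Real.exp v = Real.exp u * Real.exp (v - u) := by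
    rw [← Real.exp_add]; congr 1; ring
  have h2 : Real.exp u * (v - u + 1) ≤ Real.exp v := by
    rw [h1]; gcongr; exact Real.add_one_le_exp _
  have h3 : Real.exp u * (u - v) ≤ Real.exp M * (u - v) :=
    mul_le_mul_of_nonneg_right (Real.exp_le_exp.2 hu) (sub_nonneg.2 h)
  linarith

/-- L¹ Lipschitz estimate for the elapsed-time jump function
`f₂(σ,ξ,m,y) = -y·𝟙_{(0, y e^{-2βσm})}(ξ)` of the case γ = 1. -/
theorem stmt_17 (β : ℝ) (hβ : 0 < β) (T : ℝ) (hT : 0 < T) :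
    ∃ C > 0, ∀ y ∈ Icc (0:ℝ) T, ∀ y' ∈ Icc (0:ℝ) T,
      ∀ m ∈ Icc (-1:ℝ) 1, ∀ m' ∈ Icc (-1:ℝ) 1,
      ∀ σ ∈ ({-1, 1} : Set ℝ), ∀ σ' ∈ ({-1, 1} : Set ℝ),
      (∫ ξ in Ioi (0:ℝ),
          |(-y * (Ioo (0:ℝ) (y * Real.exp (-2 * β * σ * m))).indicator
                (fun _ => (1:ℝ)) ξ)
            - (-y' * (Ioo (0:ℝ) (y' * Real.exp (-2 * β * σ' * m'))).indicator
                (fun _ => (1:ℝ)) ξ)|)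
        ≤ C * (|m - m'| + |y - y'| + |σ - σ'|) := by
  set E := Real.exp (2 * β)
  have hE0 : 0 < E := Real.exp_pos _
  refine ⟨2 * T * E + 2 * β * T ^ 2 * E, by positivity, ?_⟩
  intro y hy y' hy' m hm m' hm' σ hσ σ' hσ'
  have hs : ∀ s ∈ ({-1, 1} : Set ℝ), |s| = 1 := by
    rintro s (rfl | rfl) <;> simp
  have hbound : ∀ s ∈ ({-1, 1} : Set ℝ), ∀ x ∈ Icc (-1:ℝ) 1, -2 * β * s * x ≤ 2 * β := by
    rintro s (rfl | rfl) x ⟨h1, h2⟩ <;> nlinarith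
  have hu := hbound σ hσ m hm
  have hv := hbound σ' hσ' m' hm'
  set u := -2 * β * σ * m with hu_def
  set v := -2 * β * σ' * m' with hv_def
  have huv : |u - v| ≤ 2 * β * (|m - m'| + |σ - σ'|) := by
    have h1 : u - v = -(2 * β) * (σ * (m - m') + (σ - σ') * m') := by
      rw [hu_def, hv_def]; ring
    rw [h1, abs_mul, abs_neg, abs_of_pos (by positivity : 0 < 2 * β)]
    gcongr
    refine (abs_add_le _ _).trans ?_
    rw [abs_mul, abs_mul, hs σ hσ, one_mul]
    gcongr
    exact mul_le_of_le_one_right (abs_nonneg _) (abs_le.2 hm')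
  have hexp : |Real.exp u - Real.exp v| ≤ E * (2 * β * (|m - m'| + |σ - σ'|)) :=
    (abs_exp_sub_exp_le hu hv).trans (by gcongr)
  have hrate : |y * Real.exp u - y' * Real.exp v|
      ≤ |y - y'| * E + T * (E * (2 * β * (|m - m'| + |σ - σ'|))) := by
    have h1 : y * Real.exp u - y' * Real.exp v
        = (y - y') * Real.exp u + y' * (Real.exp u - Real.exp v) := by ring
    rw [h1]
    refine (abs_add_le _ _).trans ?_
    rw [abs_mul, abs_mul, abs_of_nonneg hy'.1, abs_of_pos (Real.exp_pos u)]
    gcongr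
    exacts [Real.exp_le_exp.2 hu, hy'.2]
  calc _ ≤ |y - y'| * (y * Real.exp u) + |y'| * |y * Real.exp u - y' * Real.exp v| :=
        integral_abs_sub_indicator_Ioo_le (mul_nonneg hy.1 (Real.exp_pos _).le)
          (mul_nonneg hy'.1 (Real.exp_pos _).le) y y'
    _ ≤ |y - y'| * (T * E)
          + T * (|y - y'| * E + T * (E * (2 * β * (|m - m'| + |σ - σ'|)))) := by
        rw [abs_of_nonneg hy'.1]
        gcongr
        exacts [hy.2, Real.exp_le_exp.2 hu, hy'.2]
    _ = 2 * T * E * |y - y'| + 2 * β * T ^ 2 * E * (|m - m'| + |σ - σ'|) := by ring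
    _ ≤ _ := by
        have h1 : 0 ≤ 2 * T * E * (|m - m'| + |σ - σ'|) := by positivity
        have h2 : 0 ≤ 2 * β * T ^ 2 * E * |y - y'| := by positivity
        linarith
end
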